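/- Let n ≥ 3, m ≥ 0, c > 0, fix ω_0 ∈ S^{n−1} and δ > 0, and let f ∈ C_c^∞(ℝ^{1+n}; S^m). Suppose L̃^{m,m} f((t,x), ω) = 0 for all ω ∈ B_n(ω_0, δ) and all (t,x) ∈ ℝ^{1+n}. Then: if m ≥ 2 there exists f^{(m−2)} ∈ C_c^∞(ℝ^{1+n}; S^{m−2}) such that f = i_{g_{1/c}} f^{(m−2)}, and if m ∈ {0,1} then f = 0. -/

import Mathlib

open MeasureTheory Finset

noncomputable section

/-- The light direction `ω̃ = (c, ω) ∈ ℝ^{1+n}`. -/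
def ld (n : ℕ) (c : ℝ) (ω : Fin n → ℝ) : Fin (n + 1) → ℝ := Fin.cons c ω

/-- The `k`-th momentum light ray transform of a rank-`m` symmetric tensor field,
`L^{m,k} f((t,x), ω) = Σ ω̃_{i_1}⋯ω̃_{i_m} ∫ s^k f_{i_1…i_m}((t,x) + s ω̃) ds`. -/
def mlrt (n m : ℕ) (c : ℝ) (k : ℕ)
    (f : (Fin m → Fin (n + 1)) → (Fin (n + 1) → ℝ) → ℂ)
    (x : Fin (n + 1) → ℝ) (ω : Fin n → ℝ) : ℂ :=
  ∑ i : Fin m → Fin (n + 1),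
    (∏ j, (ld n c ω (i j) : ℂ)) *
      ∫ s : ℝ, (s : ℂ) ^ k * f i (x + s • ld n c ω)

/-- A tensor field is symmetric: invariant under permutations of its indices. -/
def IsSymmF (n m : ℕ) (f : (Fin m → Fin (n + 1)) → (Fin (n + 1) → ℝ) → ℂ) : Prop :=
  ∀ (σ : Equiv.Perm (Fin m)) (i : Fin m → Fin (n + 1)), f (i ∘ σ) = f i

/-- All components are smooth and compactly supported. -/
def IsCc (n m : ℕ) (f : (Fin m → Fin (n + 1)) → (Fin (n + 1) → ℝ) → ℂ) : Prop :=
  ∀ i, ContDiff ℝ (⊤ : ℕ∞) (f i) ∧ HasCompactSupport (f i)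

/-- `ω ∈ S^{n-1}` (Euclidean unit sphere). -/
def onSphere (n : ℕ) (ω : Fin n → ℝ) : Prop := ∑ i, ω i ^ 2 = 1

/-- `ω ∈ B_n(ω₀, δ)`: on the sphere and at Euclidean distance `< δ` from `ω₀`. -/
def inBall (n : ℕ) (ω₀ : Fin n → ℝ) (δ : ℝ) (ω : Fin n → ℝ) : Prop :=
  onSphere n ω ∧ ∑ i, (ω i - ω₀ i) ^ 2 < δ ^ 2

/-- The constant symmetric 2-tensor `g_{1/c} = diag(−1/c², 1, …, 1)`. -/
def gmet (n : ℕ) (c : ℝ) : Fin (n + 1) → Fin (n + 1) → ℝ :=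
  fun i j => if i = j then (if i = 0 then -(1 / c ^ 2) else 1) else 0

/-- `(i_v u)_{i_1…i_{m+2}} = (1/(m+2)!) Σ_{π} u_{i_{π(1)}…i_{π(m)}} v_{i_{π(m+1)} i_{π(m+2)}}`,
for a tensor field `u` of rank `m`. -/
def iOpF (n m : ℕ) (v : Fin (n + 1) → Fin (n + 1) → ℝ)
    (u : (Fin m → Fin (n + 1)) → (Fin (n + 1) → ℝ) → ℂ)
    (i : Fin (m + 2) → Fin (n + 1)) (x : Fin (n + 1) → ℝ) : ℂ :=
  ((m + 2).factorial : ℂ)⁻¹ *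
    ∑ π : Equiv.Perm (Fin (m + 2)),
      u (fun j => i (π (Fin.castLE (Nat.le_add_right m 2) j))) x *
        (v (i (π ⟨m, by omega⟩)) (i (π ⟨m + 1, by omega⟩)) : ℂ)



/-- Line moments. -/
lemma line_moments (m : ℕ) (φ : ℝ → ℂ) (hφ : Continuous φ) (hs : HasCompactSupport φ)
    (h : ∀ a : ℝ, ∫ s : ℝ, ((s : ℂ) - a) ^ m * φ s = 0) (k : ℕ) (hk : k ≤ m) :
    ∫ s : ℝ, (s : ℂ) ^ k * φ s = 0 := by
  have hint : ∀ k : ℕ, Integrable (fun s : ℝ => (s : ℂ) ^ k * φ s) := fun k =>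
    Continuous.integrable_of_hasCompactSupport (by fun_prop) hs.mul_left
  set P : Polynomial ℂ := ∑ k ∈ range (m + 1),
    Polynomial.C ((m.choose k : ℂ) * (-1) ^ (m - k) * ∫ s : ℝ, (s : ℂ) ^ k * φ s) *
      Polynomial.X ^ (m - k) with hP
  have hev : ∀ a : ℝ, P.eval (a : ℂ) = 0 := by
    intro a
    rw [← h a, hP, Polynomial.eval_finsetSum]
    simp only [Polynomial.eval_mul, Polynomial.eval_C, Polynomial.eval_pow, Polynomial.eval_X]
    have : ∀ s : ℝ, ((s : ℂ) - a) ^ m * φ s = ∑ k ∈ range (m + 1),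
        ((m.choose k : ℂ) * (-1) ^ (m - k) * (a : ℂ) ^ (m - k)) * ((s : ℂ) ^ k * φ s) := by
      intro s
      rw [sub_eq_add_neg, add_pow, sum_mul]
      refine sum_congr rfl fun k _ => ?_
      rw [neg_pow (a : ℂ)]; ring
    simp_rw [this]
    rw [integral_finsetSum _ fun k _ => (hint k).const_mul _]
    refine sum_congr rfl fun k _ => ?_
    rw [integral_const_mul]; ring
  have hP0 : P = 0 := by
    refine Polynomial.eq_zero_of_infinite_isRoot P ?_
    refine Set.Infinite.mono (s := Set.range ((↑) : ℝ → ℂ)) ?_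
      (Set.infinite_range_of_injective Complex.ofReal_injective)
    rintro _ ⟨a, rfl⟩
    exact hev a
  have hc := congrArg (fun Q : Polynomial ℂ => Q.coeff (m - k)) hP0
  simp only [hP, Polynomial.finsetSum_coeff, Polynomial.coeff_C_mul, Polynomial.coeff_X_pow,
    Polynomial.coeff_zero] at hc
  rw [sum_eq_single k] at hc
  · simp only [if_true, mul_one, mul_eq_zero, Nat.cast_eq_zero] at hc
    rcases hc with (hc | hc) | hc
    · exact absurd hc (Nat.choose_pos hk).ne'
    · exact absurd hc (by simp)
    · exact hc
  · intro b hb hbk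
    have := mem_range.1 hb
    rw [if_neg (by omega), mul_zero]
  · intro hk'; exact absurd (mem_range.2 (by omega)) hk'

lemma line_moments' (m : ℕ) (φ : ℝ → ℂ) (hφ : Continuous φ) (hs : HasCompactSupport φ)
    (h : ∀ a : ℝ, ∫ s : ℝ, ((s : ℂ) - a) ^ m * φ s = 0) (k : ℕ) (hk : k ≤ m) (α β : ℂ) :
    ∫ s : ℝ, (α + s * β) ^ k * φ s = 0 := by
  have hint : ∀ k : ℕ, Integrable (fun s : ℝ => (s : ℂ) ^ k * φ s) := fun k =>
    Continuous.integrable_of_hasCompactSupport (by fun_prop) hs.mul_left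
  have : ∀ s : ℝ, (α + s * β) ^ k * φ s = ∑ l ∈ range (k + 1),
      (α ^ l * β ^ (k - l) * (k.choose l)) * ((s : ℂ) ^ (k - l) * φ s) := by
    intro s
    rw [add_pow, sum_mul]
    refine sum_congr rfl fun l _ => ?_
    rw [mul_pow]; ring
  simp_rw [this]
  rw [integral_finsetSum _ fun k _ => (hint _).const_mul _]
  refine sum_eq_zero fun l _ => ?_
  rw [integral_const_mul, line_moments m φ hφ hs h _ (by omega), mul_zero]

lemma integral_piFinSucc (n : ℕ) (H : (Fin (n + 1) → ℝ) → ℂ) (hH : Continuous H)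
    (hs : HasCompactSupport H) :
    ∫ x, H x = ∫ t : ℝ, ∫ y : Fin n → ℝ, H (Fin.cons t y) := by
  have hmp := (volume_preserving_piFinSuccAbove (fun _ : Fin (n + 1) => ℝ) 0).symm
  rw [← hmp.integral_comp' (g := H)]
  rw [Measure.volume_eq_prod, integral_prod]
  · simp [MeasurableEquiv.piFinSuccAbove_symm_apply, Fin.insertNthEquiv]
  · have : Integrable H := hH.integrable_of_hasCompactSupport hs
    exact hmp.integrable_comp_of_integrable this

/-- integrate over the lines in direction `(c, ω)`. -/
lemma integral_eq_zero_of_lines (n : ℕ) (c : ℝ) (hc : 0 < c) (ω : Fin n → ℝ)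
    (H : (Fin (n + 1) → ℝ) → ℂ) (hH : Continuous H)
    (hs : HasCompactSupport H) (h : ∀ x, ∫ s : ℝ, H (x + s • ld n c ω) = 0) :
    ∫ x, H x = 0 := by
  rw [integral_piFinSucc n H hH hs]
  have h1 : ∀ t : ℝ, ∫ y : Fin n → ℝ, H (Fin.cons t y) =
      ∫ y : Fin n → ℝ, H (Fin.cons 0 y + (t / c) • ld n c ω) := by
    intro t
    rw [← integral_add_right_eq_self _ ((t / c) • ω)]
    refine integral_congr_ae (ae_of_all _ fun y => ?_)
    simp only
    congr 1
    ext i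
    refine Fin.cases ?_ (fun i => ?_) i
    · simp [ld]; field_simp
    · simp [ld]
  simp_rw [h1]
  -- the shear homeomorphism
  let e : ℝ × (Fin n → ℝ) ≃ₜ (Fin (n + 1) → ℝ) :=
    { toFun := fun p => Fin.cons 0 p.2 + (p.1 / c) • ld n c ω
      invFun := fun x => (x 0, fun i => x i.succ - (x 0 / c) * ω i)
      left_inv := by
        rintro ⟨t, y⟩
        ext i
        · simp [ld]; field_simp
        · simp [ld]; field_simp; simp
      right_inv := by
        intro x
        ext i
        refine Fin.cases ?_ (fun i => ?_) i
        · simp [ld]; field_simp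
        · simp [ld]
      continuous_toFun := by
        refine continuous_pi fun i => ?_
        refine Fin.cases ?_ (fun i => ?_) i
        · simp [ld]; fun_prop
        · simp [ld]; fun_prop
      continuous_invFun := by fun_prop }
  have hint : Integrable (Function.uncurry fun (t : ℝ) (y : Fin n → ℝ) =>
      H (Fin.cons 0 y + (t / c) • ld n c ω)) (volume.prod volume) := by
    refine Continuous.integrable_of_hasCompactSupport (hH.comp e.continuous) ?_
    exact hs.comp_homeomorph e
  rw [integral_integral_swap hint]
  have : ∀ y : Fin n → ℝ, ∫ t : ℝ, H (Fin.cons 0 y + (t / c) • ld n c ω) = 0 := by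
    intro y
    have := Measure.integral_comp_div (fun s : ℝ => H (Fin.cons 0 y + s • ld n c ω)) c
    rw [this, h, smul_zero]
  simp [this]


/-- Contraction of the tensor field with `v^{⊗ m}`. -/
def gv (n m : ℕ) (f : (Fin m → Fin (n + 1)) → (Fin (n + 1) → ℝ) → ℂ)
    (v : Fin (n + 1) → ℝ) (x : Fin (n + 1) → ℝ) : ℂ :=
  ∑ i : Fin m → Fin (n + 1), (∏ j, (v (i j) : ℂ)) * f i x

lemma gv_smul {n m : ℕ} (f : (Fin m → Fin (n + 1)) → (Fin (n + 1) → ℝ) → ℂ)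
    (r : ℝ) (v x : Fin (n + 1) → ℝ) :
    gv n m f (r • v) x = (r : ℂ) ^ m * gv n m f v x := by
  simp only [gv, mul_sum]
  refine sum_congr rfl fun i _ => ?_
  simp [Finset.prod_mul_distrib]
  ring

lemma gv_continuous {n m : ℕ} {f : (Fin m → Fin (n + 1)) → (Fin (n + 1) → ℝ) → ℂ}
    (hreg : IsCc n m f) (v : Fin (n + 1) → ℝ) : Continuous (gv n m f v) := by
  unfold gv
  exact continuous_finsetSum _ fun i _ => continuous_const.mul (hreg i).1.continuous

lemma gv_compact {n m : ℕ} {f : (Fin m → Fin (n + 1)) → (Fin (n + 1) → ℝ) → ℂ}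
    (hreg : IsCc n m f) (v : Fin (n + 1) → ℝ) : HasCompactSupport (gv n m f v) := by
  have hK : IsCompact (⋃ i, tsupport (f i)) := isCompact_iUnion fun i => (hreg i).2
  refine HasCompactSupport.intro hK fun x hx => ?_
  refine sum_eq_zero fun i _ => ?_
  have : f i x = 0 := image_eq_zero_of_notMem_tsupport fun h => hx (Set.mem_iUnion.2 ⟨i, h⟩)
  rw [this, mul_zero]

lemma line_compact {n : ℕ} {g : (Fin (n + 1) → ℝ) → ℂ} (hg : HasCompactSupport g)
    (x v : Fin (n + 1) → ℝ) (hv : v ≠ 0) : HasCompactSupport (fun s : ℝ => g (x + s • v)) := by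
  have := (Homeomorph.addLeft x).isClosedEmbedding.comp (isClosedEmbedding_smul_left (𝕜 := ℝ) hv)
  exact hg.comp_isClosedEmbedding this

lemma ld_ne_zero {n : ℕ} {c : ℝ} (hc : 0 < c) (ω : Fin n → ℝ) : ld n c ω ≠ 0 := by
  intro h
  have := congrFun h 0
  simp [ld] at this
  exact hc.ne' this

lemma mlrt_eq {n m : ℕ} {c : ℝ} (hc : 0 < c)
    {f : (Fin m → Fin (n + 1)) → (Fin (n + 1) → ℝ) → ℂ}
    (hreg : IsCc n m f) (k : ℕ) (x : Fin (n + 1) → ℝ) (ω : Fin n → ℝ) :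
    mlrt n m c k f x ω = ∫ s : ℝ, (s : ℂ) ^ k * gv n m f (ld n c ω) (x + s • ld n c ω) := by
  have hint : ∀ i, Integrable (fun s : ℝ => (s : ℂ) ^ k * f i (x + s • ld n c ω)) := fun i => by
    refine Continuous.integrable_of_hasCompactSupport ?_ (line_compact (hreg i).2 x _
      (ld_ne_zero hc ω)).mul_left
    have := (hreg i).1.continuous
    fun_prop
  unfold mlrt gv
  simp_rw [mul_sum]
  rw [integral_finsetSum]
  · refine sum_congr rfl fun i _ => ?_
    rw [← integral_const_mul]
    congr 1; ext s; ring
  · intro i _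
    have := (hint i).const_mul (∏ j, (ld n c ω (i j) : ℂ))
    refine this.congr (ae_of_all _ fun s => ?_)
    simp only; ring

lemma moments {n m : ℕ} {c : ℝ} (hc : 0 < c)
    {f : (Fin m → Fin (n + 1)) → (Fin (n + 1) → ℝ) → ℂ}
    (hreg : IsCc n m f) (ω : Fin n → ℝ) (h : ∀ x, mlrt n m c m f x ω = 0)
    (ξ : Fin (n + 1) → ℝ) (hξ : ld n c ω ⬝ᵥ ξ = 0) (k : ℕ) (hk : k ≤ m) :
    ∫ x, (Real.exp (x ⬝ᵥ ξ) : ℂ) * (x 0 : ℂ) ^ k * gv n m f (ld n c ω) x = 0 := by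
  set v := ld n c ω with hv
  have hg := gv_continuous hreg v
  have hgs := gv_compact hreg v
  have hexp : Continuous fun x : Fin (n + 1) → ℝ => (Real.exp (x ⬝ᵥ ξ) : ℂ) := by
    unfold dotProduct; fun_prop
  refine integral_eq_zero_of_lines n c hc ω _ (by fun_prop) hgs.mul_left ?_
  intro x
  rw [← hv]
  have h1 : ∀ s : ℝ, (Real.exp ((x + s • v) ⬝ᵥ ξ) : ℂ) * ((x + s • v) 0 : ℂ) ^ k *
      gv n m f v (x + s • v) = (Real.exp (x ⬝ᵥ ξ) : ℂ) *
        (((x 0 : ℂ) + s * c) ^ k * gv n m f v (x + s • v)) := by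
    intro s
    rw [add_dotProduct, smul_dotProduct, hξ, smul_zero, add_zero]
    have : v 0 = c := by simp [hv, ld]
    simp [this]
    ring
  have h2 : ∫ s : ℝ, ((x 0 : ℂ) + s * c) ^ k * gv n m f v (x + s • v) = 0 := by
    refine line_moments' m (fun s => gv n m f v (x + s • v)) (by fun_prop)
      (line_compact hgs x v (ld_ne_zero hc ω)) ?_ k hk _ _
    intro a
    have h3 := h (x + a • v)
    rw [mlrt_eq hc hreg, ← hv] at h3
    rw [← integral_add_right_eq_self _ a, ← h3]
    congr 1; ext s
    simp only [Complex.ofReal_add, add_sub_cancel_right]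
    congr 2
    rw [add_smul]; abel
  simp_rw [h1]
  rw [integral_const_mul, h2, mul_zero]

/-- The null vectors whose direction is in the ball. -/
def InCone (n : ℕ) (c : ℝ) (ω₀ : Fin n → ℝ) (δ : ℝ) (v : Fin (n + 1) → ℝ) : Prop :=
  0 < v 0 ∧ c ^ 2 * ∑ i : Fin n, v i.succ ^ 2 = v 0 ^ 2 ∧
    ∑ i : Fin n, (c * v i.succ / v 0 - ω₀ i) ^ 2 < δ ^ 2

lemma InCone.exists {n : ℕ} {c : ℝ} (hc : 0 < c) {ω₀ : Fin n → ℝ} {δ : ℝ} {v : Fin (n + 1) → ℝ}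
    (h : InCone n c ω₀ δ v) :
    ∃ ω, inBall n ω₀ δ ω ∧ v = (v 0 / c) • ld n c ω := by
  obtain ⟨h0, h1, h2⟩ := h
  refine ⟨fun i => c * v i.succ / v 0, ⟨?_, h2⟩, ?_⟩
  · unfold onSphere
    simp_rw [div_pow, mul_pow]
    rw [← Finset.sum_div, ← Finset.mul_sum, h1, div_self (by positivity)]
  · ext i
    refine Fin.cases ?_ (fun i => ?_) i
    · simp [ld]; field_simp
    · simp [ld]; field_simp

lemma moments_cone {n m : ℕ} {c : ℝ} (hc : 0 < c)
    {f : (Fin m → Fin (n + 1)) → (Fin (n + 1) → ℝ) → ℂ}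
    (hreg : IsCc n m f) {ω₀ : Fin n → ℝ} {δ : ℝ}
    (h : ∀ (x : Fin (n + 1) → ℝ) (ω : Fin n → ℝ), inBall n ω₀ δ ω →
      mlrt n m c m f x ω = 0)
    (v : Fin (n + 1) → ℝ) (hv : InCone n c ω₀ δ v)
    (ξ : Fin (n + 1) → ℝ) (hξ : v ⬝ᵥ ξ = 0) (k : ℕ) (hk : k ≤ m) :
    ∫ x, (Real.exp (x ⬝ᵥ ξ) : ℂ) * (x 0 : ℂ) ^ k * gv n m f v x = 0 := by
  obtain ⟨ω, hω, hvω⟩ := hv.exists hc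
  have h0 : v 0 / c ≠ 0 := (div_pos hv.1 hc).ne'
  rw [hvω] at hξ ⊢
  rw [smul_dotProduct, smul_eq_mul, mul_eq_zero, or_iff_right h0] at hξ
  have := moments hc hreg ω (fun x => h x ω hω) ξ hξ k hk
  simp_rw [gv_smul, mul_left_comm _ (_ ^ m)]
  rw [integral_const_mul, this, mul_zero]


/-- Taylor remainder of the exponential. -/
def expRem (m : ℕ) (y : ℝ) : ℝ := Real.exp y - ∑ k ∈ range (m + 1), y ^ k / k.factorial

lemma expRem_bound (m : ℕ) : ∃ C : ℝ, 0 ≤ C ∧ ∀ y : ℝ, |y| ≤ 1 → |expRem m y| ≤ C * |y| ^ (m + 1) := by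
  refine ⟨((m.succ).succ : ℝ) / ((m.succ).factorial * (m.succ : ℕ)), by positivity, fun y hy => ?_⟩
  have := Real.exp_bound hy (Nat.succ_pos m)
  rw [mul_comm] at this
  exact_mod_cast this

lemma expRem_continuous (m : ℕ) : Continuous (expRem m) := by
  unfold expRem; fun_prop

lemma exp_dot_continuous {n : ℕ} (ξ : Fin (n + 1) → ℝ) :
    Continuous fun x : Fin (n + 1) → ℝ => (Real.exp (x ⬝ᵥ ξ) : ℂ) := by
  unfold dotProduct; fun_prop

lemma rem_integral_bound (n m : ℕ) (φ : (Fin (n + 1) → ℝ) → ℂ) (hφ : Continuous φ)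
    (hs : HasCompactSupport φ) (ξ : Fin (n + 1) → ℝ) :
    ∃ C : ℝ, 0 ≤ C ∧ ∃ ε > 0, ∀ z : ℝ, |z| ≤ ε →
      ‖∫ x, (Real.exp (x ⬝ᵥ (ξ + z • Pi.single 0 1)) : ℂ) * (expRem m (-z * x 0) : ℂ) * φ x‖ ≤
        C * |z| ^ (m + 1) := by
  obtain ⟨C, hC0, hC⟩ := expRem_bound m
  obtain ⟨M, hM⟩ := hs.isCompact.bddAbove_image (f := fun x : Fin (n + 1) → ℝ => |x 0|)
    (by fun_prop)
  set M' := max M 1 with hM'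
  have hM1 : 1 ≤ M' := le_max_right _ _
  have hMx : ∀ x, φ x ≠ 0 → |x 0| ≤ M' := fun x hx =>
    (hM (Set.mem_image_of_mem _ (subset_tsupport φ hx))).trans (le_max_left _ _)
  have hint : Integrable fun x => ‖(Real.exp (x ⬝ᵥ ξ) : ℂ) * φ x‖ := by
    refine Integrable.norm ?_
    exact Continuous.integrable_of_hasCompactSupport ((exp_dot_continuous ξ).mul hφ) hs.mul_left
  refine ⟨(Real.exp 1 * (C * M' ^ (m + 1))) * ∫ x, ‖(Real.exp (x ⬝ᵥ ξ) : ℂ) * φ x‖, by positivity,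
    1 / M', by positivity, fun z hz => ?_⟩
  have hb : ∀ x, ‖(Real.exp (x ⬝ᵥ (ξ + z • Pi.single 0 1)) : ℂ) * (expRem m (-z * x 0) : ℂ) * φ x‖ ≤
      (Real.exp 1 * (C * M' ^ (m + 1)) * |z| ^ (m + 1)) * ‖(Real.exp (x ⬝ᵥ ξ) : ℂ) * φ x‖ := by
    intro x
    by_cases hx : φ x = 0
    · simp [hx]
    have h1 := hMx x hx
    have h2 : |z * x 0| ≤ 1 := by
      rw [abs_mul]
      calc |z| * |x 0| ≤ 1 / M' * M' := by gcongr
        _ = 1 := by field_simp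
    have h3 : x ⬝ᵥ (ξ + z • Pi.single 0 1) = x ⬝ᵥ ξ + z * x 0 := by
      simp [dotProduct_add]
    rw [h3, Real.exp_add]
    have h4 := hC (-z * x 0) (by rwa [neg_mul, abs_neg])
    rw [neg_mul, abs_neg, abs_mul] at h4
    have h5 : Real.exp (z * x 0) ≤ Real.exp 1 := Real.exp_le_exp.2 ((le_abs_self _).trans h2)
    rw [norm_mul, norm_mul, norm_mul, Complex.norm_real, Complex.norm_real, Complex.norm_real,
      Real.norm_eq_abs, Real.norm_eq_abs, Real.norm_eq_abs, abs_mul, Real.abs_exp, Real.abs_exp,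
      neg_mul]
    have h6 : |expRem m (-(z * x 0))| ≤ C * M' ^ (m + 1) * |z| ^ (m + 1) := by
      refine h4.trans ?_
      rw [mul_assoc, ← mul_pow, mul_comm M']
      gcongr
    calc Real.exp (x ⬝ᵥ ξ) * Real.exp (z * x 0) * |expRem m (-(z * x 0))| * ‖φ x‖
        ≤ Real.exp (x ⬝ᵥ ξ) * Real.exp 1 * (C * M' ^ (m + 1) * |z| ^ (m + 1)) * ‖φ x‖ := by
          gcongr
      _ = _ := by ring
  refine (norm_integral_le_of_norm_le (hint.const_mul _) (ae_of_all _ hb)).trans ?_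
  rw [integral_const_mul]
  apply le_of_eq; ring

lemma integral_exp_gv {n m : ℕ} {f : (Fin m → Fin (n + 1)) → (Fin (n + 1) → ℝ) → ℂ}
    (hreg : IsCc n m f) (v : Fin (n + 1) → ℝ) (E : (Fin (n + 1) → ℝ) → ℂ) (hE : Continuous E) :
    ∫ x, E x * gv n m f v x = ∑ i : Fin m → Fin (n + 1), (∏ j, (v (i j) : ℂ)) *
      ∫ x, E x * f i x := by
  unfold gv
  simp_rw [mul_sum]
  rw [integral_finsetSum]
  · refine sum_congr rfl fun i _ => ?_
    rw [← integral_const_mul]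
    congr 1; ext s; ring
  · intro i _
    refine Continuous.integrable_of_hasCompactSupport ?_ ((hreg i).2.mul_left.mul_left)
    have := (hreg i).1.continuous
    fun_prop

open Filter Topology in
lemma near_zero {n m : ℕ} {c : ℝ} (hc : 0 < c)
    {f : (Fin m → Fin (n + 1)) → (Fin (n + 1) → ℝ) → ℂ}
    (hreg : IsCc n m f) {ω₀ : Fin n → ℝ} {δ : ℝ}
    (h : ∀ (x : Fin (n + 1) → ℝ) (ω : Fin n → ℝ), inBall n ω₀ δ ω →
      mlrt n m c m f x ω = 0)
    (A e B : Fin (n + 1) → ℝ) (hA : InCone n c ω₀ δ A)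
    (hnull : ∀ τ : ℝ, c ^ 2 * ∑ i : Fin n, (A + τ • e + τ ^ 2 • B) i.succ ^ 2 =
      (A + τ • e + τ ^ 2 • B) 0 ^ 2)
    (ξ : Fin (n + 1) → ℝ) (hAξ : A ⬝ᵥ ξ = 0) (hBξ : B ⬝ᵥ ξ = 0) :
    ∃ C : ℝ, ∀ᶠ τ : ℝ in 𝓝 (0 : ℝ),
      ‖∫ x, (Real.exp (x ⬝ᵥ ξ) : ℂ) * gv n m f (A + τ • e + τ ^ 2 • B) x‖ ≤ C * |τ| ^ (m + 1) := by
  set V : ℝ → Fin (n + 1) → ℝ := fun τ => A + τ • e + τ ^ 2 • B with hV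
  have hVc : Continuous V := by fun_prop
  have hV0 : V 0 = A := by simp [hV]
  have hVci : ∀ i, Continuous fun τ => V τ i := fun i => (continuous_apply i).comp hVc
  have hA0 := hA.1
  -- eventual facts
  have ev1 : ∀ᶠ τ : ℝ in 𝓝 (0 : ℝ), A 0 / 2 < V τ 0 := by
    refine (hVci 0).continuousAt.eventually (lt_mem_nhds ?_)
    simp only [hV0]; linarith
  have ev2 : ∀ᶠ τ : ℝ in 𝓝 (0 : ℝ), ∑ i : Fin n, (c * V τ i.succ / V τ 0 - ω₀ i) ^ 2 < δ ^ 2 := by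
    have hcont : ContinuousAt (fun τ => ∑ i : Fin n, (c * V τ i.succ / V τ 0 - ω₀ i) ^ 2) 0 := by
      refine tendsto_finsetSum _ fun i _ => ?_
      refine ContinuousAt.pow (ContinuousAt.sub (ContinuousAt.div ?_ ?_ ?_) ?_) 2
      · exact (continuous_const.mul (hVci _)).continuousAt
      · exact (hVci 0).continuousAt
      · rw [hV0]; exact hA0.ne'
      · exact continuousAt_const
    refine hcont.eventually (gt_mem_nhds ?_)
    simp only [hV0]; exact hA.2.2
  choose C hC0 ε hε hCz using fun i => rem_integral_bound n m (f i) (hreg i).1.continuous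
    (hreg i).2 ξ
  set z : ℝ → ℝ := fun τ => -(τ * (e ⬝ᵥ ξ)) / V τ 0 with hz
  have hzc : Tendsto z (𝓝 0) (𝓝 0) := by
    have : ContinuousAt z 0 := by
      refine ContinuousAt.div (by fun_prop) (hVci 0).continuousAt ?_
      rw [hV0]; exact hA0.ne'
    have h0 : z 0 = 0 := by simp [hz]
    simpa only [ContinuousAt, h0] using this
  have ev3 : ∀ᶠ τ : ℝ in 𝓝 (0 : ℝ), ∀ i, |z τ| ≤ ε i := by
    rw [eventually_all]
    intro i
    have : ∀ᶠ y in 𝓝 (0 : ℝ), |y| ≤ ε i := by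
      refine (continuous_abs.continuousAt (x := (0:ℝ))).eventually (p := fun y => y ≤ ε i) ?_
      rw [abs_zero]; exact Iic_mem_nhds (hε i)
    exact hzc.eventually this
  have ev4 : ∀ᶠ τ : ℝ in 𝓝 (0 : ℝ), ∀ i : Fin m → Fin (n + 1),
      ‖∏ j, (V τ (i j) : ℂ)‖ ≤ ‖∏ j, (A (i j) : ℂ)‖ + 1 := by
    rw [eventually_all]
    intro i
    have hcont : Continuous fun τ => ‖∏ j, (V τ (i j) : ℂ)‖ := by
      refine continuous_norm.comp (continuous_finsetProd _ fun j _ => ?_)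
      exact Complex.continuous_ofReal.comp (hVci _)
    refine hcont.continuousAt.eventually (p := fun y => y ≤ ‖∏ j, (A (i j) : ℂ)‖ + 1) ?_
    simp only [hV0]
    exact Iic_mem_nhds (by linarith)
  set C' : ℝ := |e ⬝ᵥ ξ| / (A 0 / 2) with hC'
  refine ⟨(∑ i, (‖∏ j, (A (i j) : ℂ)‖ + 1) * C i) * C' ^ (m + 1), ?_⟩
  filter_upwards [ev1, ev2, ev3, ev4] with τ h1 h2 h3 h4
  have hVpos : 0 < V τ 0 := by linarith
  have hcone : InCone n c ω₀ δ (V τ) := ⟨hVpos, hnull τ, h2⟩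
  set ξ' := ξ + z τ • (Pi.single 0 1 : Fin (n + 1) → ℝ) with hξ'
  have hVξ' : V τ ⬝ᵥ ξ' = 0 := by
    have e1 : V τ ⬝ᵥ ξ' = V τ ⬝ᵥ ξ + z τ * V τ 0 := by
      simp [hξ', dotProduct_add]
    have e2 : V τ ⬝ᵥ ξ = τ * (e ⬝ᵥ ξ) := by
      simp [hV, add_dotProduct, hAξ, hBξ]
    rw [e1, e2, hz]
    field_simp; ring
  have hmom := fun k hk => moments_cone hc hreg h (V τ) hcone ξ' hVξ' k hk
  have hgc := gv_continuous hreg (V τ)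
  have hgs := gv_compact hreg (V τ)
  have hE' := exp_dot_continuous ξ'
  have hx0 : ∀ x : Fin (n + 1) → ℝ, x ⬝ᵥ ξ' = x ⬝ᵥ ξ + z τ * x 0 := by
    intro x; simp [hξ', dotProduct_add]
  have hsplit : ∀ x, (Real.exp (x ⬝ᵥ ξ) : ℂ) * gv n m f (V τ) x =
      (Real.exp (x ⬝ᵥ ξ') : ℂ) * (expRem m (-z τ * x 0) : ℂ) * gv n m f (V τ) x +
      ∑ k ∈ range (m + 1), ((-z τ : ℂ) ^ k / (k.factorial : ℂ)) *
        ((Real.exp (x ⬝ᵥ ξ') : ℂ) * (x 0 : ℂ) ^ k * gv n m f (V τ) x) := by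
    intro x
    have e1 : Real.exp (x ⬝ᵥ ξ) = Real.exp (x ⬝ᵥ ξ') * (expRem m (-z τ * x 0) +
        ∑ k ∈ range (m + 1), (-z τ * x 0) ^ k / k.factorial) := by
      rw [expRem, sub_add_cancel, ← Real.exp_add, hx0]
      congr 1; ring
    rw [e1]
    push_cast
    rw [mul_add, add_mul, mul_sum, sum_mul]
    congr 1
    refine sum_congr rfl fun k _ => ?_
    rw [mul_pow]; ring
  have hR : Continuous fun x : Fin (n + 1) → ℝ => (expRem m (-z τ * x 0) : ℂ) := by
    have := expRem_continuous m
    fun_prop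
  have hkey : ∫ x, (Real.exp (x ⬝ᵥ ξ) : ℂ) * gv n m f (V τ) x =
      ∫ x, (Real.exp (x ⬝ᵥ ξ') : ℂ) * (expRem m (-z τ * x 0) : ℂ) * gv n m f (V τ) x := by
    simp_rw [hsplit]
    have hik : ∀ k : ℕ, Integrable fun x : Fin (n + 1) → ℝ =>
        ((-z τ : ℂ) ^ k / (k.factorial : ℂ)) *
          ((Real.exp (x ⬝ᵥ ξ') : ℂ) * (x 0 : ℂ) ^ k * gv n m f (V τ) x) := fun k =>
      Continuous.integrable_of_hasCompactSupport (by fun_prop) hgs.mul_left.mul_left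
    rw [integral_add, integral_finsetSum]
    · rw [sum_eq_zero, add_zero]
      intro k hk
      rw [integral_const_mul, hmom k (by have := mem_range.1 hk; omega), mul_zero]
    · exact fun k _ => hik k
    · exact Continuous.integrable_of_hasCompactSupport (by fun_prop) hgs.mul_left
    · exact integrable_finsetSum _ fun k _ => hik k
  rw [hkey, integral_exp_gv hreg (V τ) (fun x => (Real.exp (x ⬝ᵥ ξ') : ℂ) *
    (expRem m (-z τ * x 0) : ℂ)) (hE'.mul hR)]
  have hzb : |z τ| ≤ C' * |τ| := by
    rw [hz, hC']
    simp only
    rw [abs_div, abs_neg, abs_mul, abs_of_pos hVpos, mul_comm |τ|, div_mul_eq_mul_div]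
    gcongr
  calc _ ≤ ∑ i : Fin m → Fin (n + 1), ‖∏ j, (V τ (i j) : ℂ)‖ * (C i * |z τ| ^ (m + 1)) := by
        refine (norm_sum_le _ _).trans (sum_le_sum fun i _ => ?_)
        rw [norm_mul]
        exact mul_le_mul_of_nonneg_left (hCz i (z τ) (h3 i)) (norm_nonneg _)
    _ ≤ ∑ i : Fin m → Fin (n + 1), (‖∏ j, (A (i j) : ℂ)‖ + 1) *
          (C i * (C' * |τ|) ^ (m + 1)) := by
        refine sum_le_sum fun i _ => ?_
        have := hC0 i
        have := h4 i
        gcongr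
    _ = _ := by
        rw [sum_mul, sum_mul]
        refine sum_congr rfl fun i _ => ?_
        ring

open Filter Topology Polynomial in
lemma X_pow_dvd_of_bound (P : ℂ[X]) (C : ℝ) (k : ℕ)
    (h : ∀ᶠ τ : ℝ in 𝓝 (0 : ℝ), ‖P.eval (τ : ℂ)‖ ≤ C * |τ| ^ k) : X ^ k ∣ P := by
  induction k generalizing C with
  | zero => simp
  | succ k ih =>
    have : X ^ k ∣ P := by
      refine ih (|C|) ?_
      have h1 : ∀ᶠ τ : ℝ in 𝓝 (0 : ℝ), |τ| ≤ 1 := by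
        refine (continuous_abs.continuousAt (x := (0:ℝ))).eventually (p := fun y => y ≤ 1) ?_
        rw [abs_zero]; exact Iic_mem_nhds (zero_lt_one' ℝ)
      filter_upwards [h, h1] with τ h2 h3
      refine h2.trans ?_
      rw [pow_succ]
      have : |τ| ^ k * |τ| ≤ |τ| ^ k := mul_le_of_le_one_right (by positivity) h3
      calc C * (|τ| ^ k * |τ|) ≤ |C| * (|τ| ^ k * |τ|) := by gcongr; exact le_abs_self C
        _ ≤ _ := by gcongr
    obtain ⟨Q, rfl⟩ := this
    rw [pow_succ]
    refine mul_dvd_mul_left _ ?_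
    rw [X_dvd_iff, coeff_zero_eq_eval_zero]
    have hb : ∀ᶠ τ : ℝ in 𝓝[≠] (0 : ℝ), ‖Q.eval (τ : ℂ)‖ ≤ C * |τ| := by
      filter_upwards [nhdsWithin_le_nhds h, self_mem_nhdsWithin] with τ h1 h2
      have h3 : (0 : ℝ) < |τ| ^ k := pow_pos (abs_pos.2 h2) k
      rw [eval_mul, eval_pow, eval_X, norm_mul, norm_pow, Complex.norm_real, Real.norm_eq_abs,
        pow_succ] at h1
      refine le_of_mul_le_mul_left ?_ h3
      linarith
    have t1 : Tendsto (fun τ : ℝ => ‖Q.eval (τ : ℂ)‖) (𝓝[≠] 0) (𝓝 ‖Q.eval ((0 : ℝ) : ℂ)‖) := by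
      have : Continuous fun τ : ℝ => ‖Q.eval (τ : ℂ)‖ := by fun_prop
      exact (this.tendsto 0).mono_left nhdsWithin_le_nhds
    have t2 : Tendsto (fun τ : ℝ => C * |τ|) (𝓝[≠] 0) (𝓝 (C * |(0 : ℝ)|)) := by
      have : Continuous fun τ : ℝ => C * |τ| := by fun_prop
      exact (this.tendsto 0).mono_left nhdsWithin_le_nhds
    have := le_of_tendsto_of_tendsto t1 t2 hb
    simpa using this

open Filter Topology Polynomial in
lemma poly_eq_zero (m : ℕ) (P P' : ℂ[X]) (C C' : ℝ)
    (h : ∀ᶠ τ : ℝ in 𝓝 (0 : ℝ), ‖P.eval (τ : ℂ)‖ ≤ C * |τ| ^ (m + 1))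
    (h' : ∀ᶠ τ : ℝ in 𝓝 (0 : ℝ), ‖P'.eval (τ : ℂ)‖ ≤ C' * |τ| ^ (m + 1))
    (hPP' : ∀ τ : ℝ, τ ≠ 0 → P.eval (τ : ℂ) = (τ : ℂ) ^ (2 * m) * P'.eval ((τ⁻¹ : ℝ) : ℂ)) :
    P = 0 := by
  obtain ⟨Q, rfl⟩ := X_pow_dvd_of_bound P C (m + 1) h
  by_contra hne
  have hQ : Q ≠ 0 := fun h => hne (by simp [h])
  have hdeg : 0 < (X ^ 2 * Q).degree := by
    rw [degree_mul, degree_X_pow, degree_eq_natDegree hQ]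
    norm_cast; omega
  have hz : Tendsto (fun τ : ℝ => ‖(τ : ℂ)‖) atTop atTop := by
    simpa using tendsto_abs_atTop_atTop (G := ℝ)
  have ht := tendsto_norm_atTop (X ^ 2 * Q) hdeg hz
  have hb : ∀ᶠ τ : ℝ in atTop, ‖(X ^ 2 * Q).eval (τ : ℂ)‖ ≤ C' := by
    filter_upwards [tendsto_inv_atTop_zero.eventually h', eventually_gt_atTop 0] with τ h1 h2
    have h3 := hPP' τ h2.ne'
    have h4 : ‖((X ^ (m + 1) * Q).eval (τ : ℂ))‖ ≤ τ ^ (2 * m) * (C' * (τ⁻¹) ^ (m + 1)) := by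
      rw [h3, norm_mul, norm_pow, Complex.norm_real, Real.norm_eq_abs, abs_of_pos h2]
      rw [abs_of_pos (inv_pos.2 h2)] at h1
      gcongr
    rw [eval_mul, eval_pow, eval_X, norm_mul, norm_pow, Complex.norm_real, Real.norm_eq_abs,
      abs_of_pos h2] at h4 ⊢
    refine le_of_mul_le_mul_left ?_ (pow_pos h2 (2 * m))
    calc τ ^ (2 * m) * (τ ^ 2 * ‖Q.eval (τ : ℂ)‖) = τ ^ (m + 1) * (τ ^ (m + 1) * ‖Q.eval (τ : ℂ)‖) := by
          ring
      _ ≤ τ ^ (m + 1) * (τ ^ (2 * m) * (C' * (τ⁻¹) ^ (m + 1))) := by gcongr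
      _ = τ ^ (2 * m) * C' * (τ * τ⁻¹) ^ (m + 1) := by rw [mul_pow]; ring
      _ = _ := by rw [mul_inv_cancel₀ h2.ne', one_pow, mul_one]
  obtain ⟨τ, h1, h2⟩ := (hb.and (ht.eventually (eventually_gt_atTop C'))).exists
  linarith


open Filter Topology Polynomial in
/-- The polynomial `τ ↦ Σ F_I ∏ (A + τ e + τ² B)_{I j}`. -/
def curvePoly (n m : ℕ) (F : (Fin m → Fin (n + 1)) → ℂ) (A e B : Fin (n + 1) → ℝ) : ℂ[X] :=
  ∑ i : Fin m → Fin (n + 1), (∏ j, (C (A (i j) : ℂ) + X * C (e (i j) : ℂ) +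
    X ^ 2 * C (B (i j) : ℂ))) * C (F i)

lemma curvePoly_eval {n m : ℕ} {f : (Fin m → Fin (n + 1)) → (Fin (n + 1) → ℝ) → ℂ}
    (hreg : IsCc n m f) (ξ A e B : Fin (n + 1) → ℝ) (τ : ℝ) :
    (curvePoly n m (fun i => ∫ x, (Real.exp (x ⬝ᵥ ξ) : ℂ) * f i x) A e B).eval (τ : ℂ) =
      ∫ x, (Real.exp (x ⬝ᵥ ξ) : ℂ) * gv n m f (A + τ • e + τ ^ 2 • B) x := by
  rw [integral_exp_gv hreg _ _ (exp_dot_continuous ξ), curvePoly, Polynomial.eval_finsetSum]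
  refine sum_congr rfl fun i _ => ?_
  simp [Polynomial.eval_prod]
  left
  exact prod_congr rfl fun j _ => by ring

lemma inBall.smul_cone {n : ℕ} {c : ℝ} (hc : 0 < c) {ω₀ ω : Fin n → ℝ} {δ : ℝ}
    (h : inBall n ω₀ δ ω) {α : ℝ} (hα : 0 < α) : InCone n c ω₀ δ (α • ld n c ω) := by
  obtain ⟨h1, h2⟩ := h
  refine ⟨by simp [ld]; positivity, ?_, ?_⟩
  · simp only [ld, Pi.smul_apply, Fin.cons_succ, Fin.cons_zero, smul_eq_mul, mul_pow]
    rw [← Finset.mul_sum]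
    unfold onSphere at h1
    rw [h1]; ring
  · convert h2 using 3 with i
    simp [ld]
    field_simp

lemma dot_lt_one {n : ℕ} {ω ω' : Fin n → ℝ} (h : onSphere n ω) (h' : onSphere n ω')
    (hne : ω ≠ ω') : ω ⬝ᵥ ω' < 1 := by
  obtain ⟨i, hi⟩ := Function.ne_iff.1 hne
  have h1 : 0 < ∑ i, (ω i - ω' i) ^ 2 := by
    refine Finset.sum_pos' (fun i _ => sq_nonneg _) ⟨i, Finset.mem_univ _, ?_⟩
    have := sub_ne_zero.2 hi
    positivity
  have h2 : ∑ i, (ω i - ω' i) ^ 2 = ∑ i, ω i ^ 2 + ∑ i, ω' i ^ 2 - 2 * (ω ⬝ᵥ ω') := by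
    unfold dotProduct
    rw [mul_sum, ← sum_add_distrib, ← sum_sub_distrib]
    exact sum_congr rfl fun i _ => by ring
  unfold onSphere at h h'
  rw [h2, h, h'] at h1
  linarith

lemma sum_sq_comb {n : ℕ} {a w b : Fin n → ℝ} (ha : onSphere n a) (hw : onSphere n w)
    (hb : onSphere n b) (r s t : ℝ) : ∑ i, (r * a i + s * w i + t * b i) ^ 2 =
      r ^ 2 + s ^ 2 + t ^ 2 + 2 * r * s * (w ⬝ᵥ a) + 2 * r * t * (a ⬝ᵥ b) + 2 * s * t * (w ⬝ᵥ b) := by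
  unfold onSphere at ha hw hb
  have : r ^ 2 + s ^ 2 + t ^ 2 = r ^ 2 * ∑ i, a i ^ 2 + s ^ 2 * ∑ i, w i ^ 2 +
      t ^ 2 * ∑ i, b i ^ 2 := by rw [ha, hw, hb]; ring
  rw [this]
  unfold dotProduct
  simp only [mul_sum, ← sum_add_distrib]
  exact sum_congr rfl fun i _ => by ring

lemma curve_null {n : ℕ} {c : ℝ} {a w b : Fin n → ℝ} (ha : onSphere n a)
    (hw : onSphere n w) (hb : onSphere n b) (α β : ℝ) (hα : α * (1 - a ⬝ᵥ b) = 1 - w ⬝ᵥ b)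
    (hβ : β * (1 - a ⬝ᵥ b) = 1 - w ⬝ᵥ a) (τ : ℝ) :
    c ^ 2 * ∑ i : Fin n, (α • ld n c a + τ • (ld n c w - α • ld n c a - β • ld n c b) +
        τ ^ 2 • (β • ld n c b)) i.succ ^ 2 =
      (α • ld n c a + τ • (ld n c w - α • ld n c a - β • ld n c b) +
        τ ^ 2 • (β • ld n c b)) 0 ^ 2 := by
  have h1 : ∀ i : Fin n, (α • ld n c a + τ • (ld n c w - α • ld n c a - β • ld n c b) +
        τ ^ 2 • (β • ld n c b)) i.succ = (α * (1 - τ)) * a i + τ * w i + (β * (τ ^ 2 - τ)) * b i := by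
    intro i; simp [ld]; ring
  have h0 : (α • ld n c a + τ • (ld n c w - α • ld n c a - β • ld n c b) +
        τ ^ 2 • (β • ld n c b)) 0 = c * ((α * (1 - τ)) + τ + (β * (τ ^ 2 - τ))) := by
    simp [ld]; ring
  simp_rw [h1]
  rw [h0, sum_sq_comb ha hw hb]
  have e1 : w ⬝ᵥ b = 1 - α * (1 - a ⬝ᵥ b) := by linarith
  have e2 : w ⬝ᵥ a = 1 - β * (1 - a ⬝ᵥ b) := by linarith
  rw [e1, e2]
  ring

lemma vanish_on_two {n m : ℕ} {c : ℝ} (hc : 0 < c)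
    {f : (Fin m → Fin (n + 1)) → (Fin (n + 1) → ℝ) → ℂ}
    (hreg : IsCc n m f) {ω₀ : Fin n → ℝ} {δ : ℝ}
    (h : ∀ (x : Fin (n + 1) → ℝ) (ω : Fin n → ℝ), inBall n ω₀ δ ω →
      mlrt n m c m f x ω = 0)
    (a b w : Fin n → ℝ) (ha : inBall n ω₀ δ a) (hb : inBall n ω₀ δ b) (hab : a ≠ b)
    (hw : onSphere n w) (ξ : Fin (n + 1) → ℝ) (haξ : ld n c a ⬝ᵥ ξ = 0)
    (hbξ : ld n c b ⬝ᵥ ξ = 0) :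
    ∫ x, (Real.exp (x ⬝ᵥ ξ) : ℂ) * gv n m f (ld n c w) x = 0 := by
  by_cases hwa : w = a
  · subst hwa
    simpa using moments hc hreg w (fun x => h x w ha) ξ haξ 0 (Nat.zero_le _)
  by_cases hwb : w = b
  · subst hwb
    simpa using moments hc hreg w (fun x => h x w hb) ξ hbξ 0 (Nat.zero_le _)
  have hp := dot_lt_one ha.1 hb.1 hab
  have hpa := dot_lt_one hw ha.1 hwa
  have hpb := dot_lt_one hw hb.1 hwb
  set α := (1 - w ⬝ᵥ b) / (1 - a ⬝ᵥ b) with hα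
  set β := (1 - w ⬝ᵥ a) / (1 - a ⬝ᵥ b) with hβ
  have hp0 : 0 < 1 - a ⬝ᵥ b := by linarith
  have hαpos : 0 < α := div_pos (by linarith) hp0
  have hβpos : 0 < β := div_pos (by linarith) hp0
  have hα' : α * (1 - a ⬝ᵥ b) = 1 - w ⬝ᵥ b := div_mul_cancel₀ _ hp0.ne'
  have hβ' : β * (1 - a ⬝ᵥ b) = 1 - w ⬝ᵥ a := div_mul_cancel₀ _ hp0.ne'
  set e := ld n c w - α • ld n c a - β • ld n c b with he
  have he' : e = ld n c w - β • ld n c b - α • ld n c a := by rw [he]; abel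
  have hA : (α • ld n c a) ⬝ᵥ ξ = 0 := by rw [smul_dotProduct, haξ, smul_zero]
  have hB : (β • ld n c b) ⬝ᵥ ξ = 0 := by rw [smul_dotProduct, hbξ, smul_zero]
  obtain ⟨C1, h1⟩ := near_zero hc hreg h (α • ld n c a) e (β • ld n c b) (ha.smul_cone hc hαpos)
    (curve_null ha.1 hw hb.1 α β hα' hβ') ξ hA hB
  obtain ⟨C2, h2⟩ := near_zero hc hreg h (β • ld n c b) e (α • ld n c a) (hb.smul_cone hc hβpos)
    (by
      rw [he']
      exact curve_null hb.1 hw ha.1 β α (by rw [dotProduct_comm b a, hβ'])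
        (by rw [dotProduct_comm b a, hα'])) ξ hB hA
  simp_rw [← curvePoly_eval hreg] at h1 h2
  have hP := poly_eq_zero m _ _ C1 C2 h1 h2 (by
    intro τ hτ
    rw [curvePoly_eval hreg, curvePoly_eval hreg]
    have : α • ld n c a + τ • e + τ ^ 2 • (β • ld n c b) = τ ^ 2 •
        (β • ld n c b + τ⁻¹ • e + τ⁻¹ ^ 2 • (α • ld n c a)) := by
      ext i
      simp only [Pi.add_apply, Pi.smul_apply, smul_eq_mul]
      field_simp
      ring
    rw [this]
    simp_rw [gv_smul, mul_left_comm _ (_ ^ m)]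
    rw [integral_const_mul, pow_mul]
    push_cast
    rfl)
  have := curvePoly_eval hreg ξ (α • ld n c a) e (β • ld n c b) 1
  rw [hP] at this
  simp only [Polynomial.eval_zero] at this
  rw [this]
  have hv : α • ld n c a + (1 : ℝ) • e + (1 : ℝ) ^ 2 • (β • ld n c b) = ld n c w := by
    rw [he, one_pow, one_smul, one_smul]; abel
  rw [hv]

/-- The exponentials with frequencies in an open convex cone separate functions. -/
lemma real_eq_zero_of_exp (N : ℕ) (U : Set (Fin N → ℝ)) (hU : IsOpen U)
    (hadd : ∀ x ∈ U, ∀ y ∈ U, x + y ∈ U) (hne : U.Nonempty) (g : (Fin N → ℝ) → ℝ)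
    (hg : Continuous g) (hs : HasCompactSupport g)
    (h : ∀ ξ ∈ U, ∫ x, Real.exp (x ⬝ᵥ ξ) * g x = 0) (x : Fin N → ℝ) : g x = 0 := by
  obtain ⟨ξ₀, hξ₀⟩ := hne
  let E : (Fin N → ℝ) → C(Fin N → ℝ, ℝ) := fun ξ =>
    ⟨fun x => Real.exp (x ⬝ᵥ ξ), by unfold dotProduct; fun_prop⟩
  have hE : ∀ ξ x, E ξ x = Real.exp (x ⬝ᵥ ξ) := fun _ _ => rfl
  let S : Set C(Fin N → ℝ, ℝ) := E '' U
  let A : Subalgebra ℝ C(Fin N → ℝ, ℝ) := Algebra.adjoin ℝ S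
  set G : (Fin N → ℝ) → ℝ := fun x => Real.exp (x ⬝ᵥ ξ₀) * g x with hG
  have hGc : Continuous G := by
    have := (E ξ₀).continuous
    exact this.mul hg
  have hGs : HasCompactSupport G := hs.mul_left
  have hmon : ∀ p ∈ Submonoid.closure S, p = 1 ∨ p ∈ S := by
    intro p hp
    induction hp using Submonoid.closure_induction with
    | mem x hx => exact Or.inr hx
    | one => exact Or.inl rfl
    | mul p q _ _ h1 h2 =>
      rcases h1 with rfl | ⟨ξ, hξ, rfl⟩
      · simpa using h2
      rcases h2 with rfl | ⟨ξ', hξ', rfl⟩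
      · right; rw [mul_one]; exact ⟨ξ, hξ, rfl⟩
      · right
        refine ⟨ξ + ξ', hadd _ hξ _ hξ', ?_⟩
        ext x
        simp [hE, dotProduct_add, Real.exp_add]
  have hint : ∀ p : C(Fin N → ℝ, ℝ), Integrable fun x => p x * G x := fun p =>
    Continuous.integrable_of_hasCompactSupport (p.continuous.mul hGc) hGs.mul_left
  have hzero : ∀ p ∈ A, ∫ x, p x * G x = 0 := by
    intro p hp
    have hp' : p ∈ Submodule.span ℝ (Submonoid.closure S : Set C(Fin N → ℝ, ℝ)) := by
      rw [← Algebra.adjoin_eq_span]; exact hp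
    clear hp
    induction hp' using Submodule.span_induction with
    | mem p hp =>
      rcases hmon p hp with rfl | ⟨ξ, hξ, rfl⟩
      · simpa [hG] using h ξ₀ hξ₀
      · rw [← h _ (hadd _ hξ _ hξ₀)]
        congr 1; ext x
        simp only [hE, hG, dotProduct_add, Real.exp_add]; ring
    | zero => simp
    | add p q hp hq h1 h2 =>
      simp only [ContinuousMap.add_apply, add_mul]
      rw [integral_add (hint p) (hint q), h1, h2, add_zero]
    | smul r p hp h1 =>
      simp only [ContinuousMap.smul_apply, smul_eq_mul, mul_assoc]
      rw [integral_const_mul, h1, mul_zero]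
  have hsep : A.SeparatesPoints := by
    intro x y hxy
    by_contra hcon
    push Not at hcon
    have hd : ∀ ξ ∈ U, (x - y) ⬝ᵥ ξ = 0 := by
      intro ξ hξ
      have := hcon (E ξ) ⟨E ξ, Algebra.subset_adjoin ⟨ξ, hξ, rfl⟩, rfl⟩
      rw [hE, hE, Real.exp_eq_exp] at this
      rw [sub_dotProduct, this, sub_self]
    have hcont : Continuous fun t : ℝ => ξ₀ + t • (x - y) := by fun_prop
    have hev : ∀ᶠ t : ℝ in nhdsWithin 0 {0}ᶜ, ξ₀ + t • (x - y) ∈ U := by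
      refine Filter.Eventually.filter_mono nhdsWithin_le_nhds ?_
      refine hcont.continuousAt.eventually (hU.mem_nhds ?_)
      simpa using hξ₀
    obtain ⟨t, ht, ht0⟩ := (hev.and self_mem_nhdsWithin).exists
    have h1 := hd _ ht
    have ht1 : t ≠ 0 := ht0
    rw [dotProduct_add, hd _ hξ₀, zero_add, dotProduct_smul, smul_eq_mul, mul_eq_zero,
      or_iff_right ht1, dotProduct_self_eq_zero] at h1
    exact hxy (sub_eq_zero.1 h1)
  have hGsq : ∫ x, G x * G x = 0 := by
    have hnn : 0 ≤ ∫ x, G x * G x := integral_nonneg fun x => mul_self_nonneg _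
    refine le_antisymm (le_of_forall_pos_le_add fun ε hε => ?_) hnn
    have hI : 0 ≤ ∫ x, |G x| := integral_nonneg fun x => abs_nonneg _
    set I := ∫ x, |G x|
    have hη : 0 < ε / (I + 1) := by positivity
    obtain ⟨p, hpA, hp⟩ :=
      ContinuousMap.exists_mem_subalgebra_near_continuous_of_isCompact_of_separatesPoints hsep
        ⟨G, hGc⟩ hGs.isCompact hη
    have e1 : ∫ x, G x * G x = ∫ x, (G x - p x) * G x := by
      simp only [sub_mul]
      have hh := hint ⟨G, hGc⟩
      simp only [ContinuousMap.coe_mk] at hh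
      rw [integral_sub hh (hint p), hzero p hpA, sub_zero]
    have hGi : Integrable fun x => |G x| :=
      (hGc.integrable_of_hasCompactSupport hGs).abs
    have e2 : ∫ x, (G x - p x) * G x ≤ ∫ x, ε / (I + 1) * |G x| := by
      refine integral_mono (hint (⟨G, hGc⟩ - p)) (hGi.const_mul _) fun x => ?_
      by_cases hx : G x = 0
      · simp [hx]
      have := hp x (subset_tsupport G hx)
      rw [Real.norm_eq_abs, abs_sub_comm] at this
      calc (G x - p x) * G x ≤ |(G x - p x) * G x| := le_abs_self _
        _ = |G x - p x| * |G x| := abs_mul _ _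
        _ ≤ _ := by
          have := this.le
          simp only [ContinuousMap.coe_mk] at this
          gcongr
    rw [e1, zero_add]
    refine e2.trans ?_
    rw [integral_const_mul, div_mul_eq_mul_div, div_le_iff₀ (by positivity)]
    change ε * I ≤ _
    nlinarith
  have hGG : (fun x => G x * G x) = 0 := by
    have hh := hint ⟨G, hGc⟩
    simp only [ContinuousMap.coe_mk] at hh
    have := (integral_eq_zero_iff_of_nonneg (fun x => mul_self_nonneg (G x)) hh).1 hGsq
    exact Measure.eq_of_ae_eq this (hGc.mul hGc) continuous_zero
  have := congrFun hGG x
  simpa [hG, (Real.exp_pos _).ne'] using this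

lemma exists_orth {n k : ℕ} (hk : k < n) (v : Fin k → Fin n → ℝ) :
    ∃ η : Fin n → ℝ, η ≠ 0 ∧ ∀ j, v j ⬝ᵥ η = 0 := by
  have h := LinearMap.ker_ne_bot_of_finrank_lt (f := Matrix.mulVecLin (Matrix.of v)) (by simpa using hk)
  obtain ⟨η, h1, h2⟩ := (Submodule.ne_bot_iff _).1 h
  refine ⟨η, h2, fun j => ?_⟩
  have := congrFun (LinearMap.mem_ker.1 h1) j
  simpa [Matrix.mulVec] using this

/-- A nonempty open convex cone of frequencies orthogonal to two light directions of the ball. -/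
lemma freq_cone {n : ℕ} (hn : 3 ≤ n) (c : ℝ) (ω₀ : Fin n → ℝ) (hω₀ : onSphere n ω₀)
    (δ : ℝ) (hδ : 0 < δ) : ∃ U : Set (Fin (n + 1) → ℝ), IsOpen U ∧
      (∀ x ∈ U, ∀ y ∈ U, x + y ∈ U) ∧ U.Nonempty ∧
      ∀ ξ ∈ U, ∃ a b, inBall n ω₀ δ a ∧ inBall n ω₀ δ b ∧ a ≠ b ∧ ld n c a ⬝ᵥ ξ = 0 ∧
        ld n c b ⬝ᵥ ξ = 0 := by
  obtain ⟨η, hη0, hη⟩ := exists_orth (n := n) (k := 1) (by omega) ![ω₀]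
  obtain ⟨ζ, hζ0, hζ⟩ := exists_orth (n := n) (k := 2) (by omega) ![ω₀, η]
  have hη1 : ω₀ ⬝ᵥ η = 0 := by simpa using hη 0
  have hζ1 : ω₀ ⬝ᵥ ζ = 0 := by simpa using hζ 0
  have hζ2 : η ⬝ᵥ ζ = 0 := by simpa using hζ 1
  have hω1 : ω₀ ⬝ᵥ ω₀ = 1 := by
    unfold onSphere at hω₀; rw [← hω₀]; simp [dotProduct, sq]
  have hηη : 0 < η ⬝ᵥ η := by
    refine lt_of_le_of_ne (sum_nonneg fun i _ => mul_self_nonneg _) fun h => hη0 ?_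
    exact dotProduct_self_eq_zero.1 h.symm
  have hζζ : 0 < ζ ⬝ᵥ ζ := by
    refine lt_of_le_of_ne (sum_nonneg fun i _ => mul_self_nonneg _) fun h => hζ0 ?_
    exact dotProduct_self_eq_zero.1 h.symm
  let w : ℝ × ℝ → Fin n → ℝ := fun p => ω₀ + p.1 • ζ + p.2 • η
  have hwc : Continuous w := by fun_prop
  let q : ℝ × ℝ → ℝ := fun p => ∑ i, w p i ^ 2
  have hq : Continuous q := by fun_prop
  have hqpos : ∀ p, 0 < q p := by
    intro p
    refine lt_of_le_of_ne (sum_nonneg fun i _ => sq_nonneg _) fun h => ?_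
    have h0 : w p = 0 := by
      rw [← dotProduct_self_eq_zero, h]; simp [dotProduct, q, sq]
    have h1 : ω₀ ⬝ᵥ w p = 1 := by
      simp [w, dotProduct_add, dotProduct_smul, hη1, hζ1, hω1]
    rw [h0] at h1
    simp at h1
  have hsq : ∀ p, 0 < √(q p) := fun p => Real.sqrt_pos.2 (hqpos p)
  let γ : ℝ × ℝ → Fin n → ℝ := fun p => (√(q p))⁻¹ • w p
  have hγ : Continuous γ := (Continuous.inv₀ hq.sqrt fun p => (hsq p).ne').smul hwc
  have hγs : ∀ p, onSphere n (γ p) := by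
    intro p
    unfold onSphere
    simp only [γ, Pi.smul_apply, smul_eq_mul, mul_pow]
    rw [← mul_sum, inv_pow, Real.sq_sqrt (hqpos p).le]
    exact inv_mul_cancel₀ (hqpos p).ne'
  have hγ0 : γ 0 = ω₀ := by
    have : q 0 = 1 := by simpa [q, w, onSphere] using hω₀
    simp [γ, this, w]
  have hev : ∀ᶠ p in nhds (0 : ℝ × ℝ), ∑ i, (γ p i - ω₀ i) ^ 2 < δ ^ 2 := by
    have hc' : Continuous fun p => ∑ i, (γ p i - ω₀ i) ^ 2 := by fun_prop
    refine hc'.continuousAt.eventually_lt continuousAt_const ?_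
    simp [hγ0]; positivity
  obtain ⟨r, hr, hball⟩ := Metric.eventually_nhds_iff.1 hev
  set ε := r / 2 with hε
  have hε0 : 0 < ε := by positivity
  have hin : ∀ s t : ℝ, |s| ≤ ε → |t| ≤ ε → inBall n ω₀ δ (γ (s, t)) := by
    intro s t hs ht
    refine ⟨hγs _, hball ?_⟩
    rw [dist_zero_right, Prod.norm_def, Real.norm_eq_abs, Real.norm_eq_abs]
    exact max_lt (by linarith) (by linarith)
  let L : ℝ → ℝ → (Fin (n + 1) → ℝ) → ℝ := fun s t ξ => ld n c (γ (s, t)) ⬝ᵥ ξ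
  have hLc : ∀ s t, Continuous (L s t) := fun s t => by
    simp only [L, dotProduct]; fun_prop
  have hLadd : ∀ s t x y, L s t (x + y) = L s t x + L s t y := fun s t x y => dotProduct_add _ _ _
  have hLt : ∀ s ξ, Continuous fun t => L s t ξ := fun s ξ => by
    have : Continuous fun t : ℝ => γ (s, t) := hγ.comp (by fun_prop)
    simp only [L, dotProduct, Fin.sum_univ_succ, ld, Fin.cons_zero, Fin.cons_succ]
    fun_prop
  have hζγ : ∀ s t, γ (s, t) ⬝ᵥ ζ = (√(q (s, t)))⁻¹ * (s * (ζ ⬝ᵥ ζ)) := by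
    intro s t
    simp [γ, w, smul_dotProduct, add_dotProduct, hζ1, hζ2]
  have hηγ : ∀ s t, γ (s, t) ⬝ᵥ η = (√(q (s, t)))⁻¹ * (t * (η ⬝ᵥ η)) := by
    intro s t
    simp [γ, w, smul_dotProduct, add_dotProduct, hη1, dotProduct_comm ζ η, hζ2]
  have hLη : ∀ s t, L s t (Fin.cons 0 η) = (√(q (s, t)))⁻¹ * (t * (η ⬝ᵥ η)) := by
    intro s t
    rw [← hηγ]
    simp [L, dotProduct, Fin.sum_univ_succ, ld]
  have hivt : ∀ s ξ, 0 < L s ε ξ → L s (-ε) ξ < 0 → ∃ t, |t| ≤ ε ∧ L s t ξ = 0 := by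
    intro s ξ h1 h2
    obtain ⟨t, ht, h0⟩ := intermediate_value_Icc (by linarith : -ε ≤ ε) (hLt s ξ).continuousOn
      (⟨h2.le, h1.le⟩ : (0 : ℝ) ∈ Set.Icc (L s (-ε) ξ) (L s ε ξ))
    exact ⟨t, abs_le.2 ht, h0⟩
  refine ⟨{ξ | (0 < L ε ε ξ ∧ L ε (-ε) ξ < 0) ∧ (0 < L (-ε) ε ξ ∧ L (-ε) (-ε) ξ < 0)},
    ?_, ?_, ?_, ?_⟩
  · exact ((isOpen_lt continuous_const (hLc _ _)).inter (isOpen_lt (hLc _ _) continuous_const)).inter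
      ((isOpen_lt continuous_const (hLc _ _)).inter (isOpen_lt (hLc _ _) continuous_const))
  · rintro x ⟨⟨h1, h2⟩, h3, h4⟩ y ⟨⟨k1, k2⟩, k3, k4⟩
    refine ⟨⟨?_, ?_⟩, ?_, ?_⟩ <;> rw [hLadd] <;> linarith
  · refine ⟨Fin.cons 0 η, ⟨?_, ?_⟩, ?_, ?_⟩ <;> rw [hLη]
    · exact mul_pos (inv_pos.2 (hsq _)) (mul_pos hε0 hηη)
    · exact mul_neg_of_pos_of_neg (inv_pos.2 (hsq _)) (mul_neg_of_neg_of_pos (by linarith) hηη)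
    · exact mul_pos (inv_pos.2 (hsq _)) (mul_pos hε0 hηη)
    · exact mul_neg_of_pos_of_neg (inv_pos.2 (hsq _)) (mul_neg_of_neg_of_pos (by linarith) hηη)
  · rintro ξ ⟨⟨h1, h2⟩, h3, h4⟩
    obtain ⟨t, ht, e1⟩ := hivt _ _ h1 h2
    obtain ⟨t', ht', e2⟩ := hivt _ _ h3 h4
    refine ⟨γ (ε, t), γ (-ε, t'), hin _ _ (abs_of_pos hε0).le ht,
      hin _ _ (by rw [abs_neg, abs_of_pos hε0]) ht', ?_, e1, e2⟩
    intro heq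
    have := congrArg (· ⬝ᵥ ζ) heq
    simp only [hζγ] at this
    have p1 : 0 < (√(q (ε, t)))⁻¹ * (ε * (ζ ⬝ᵥ ζ)) := mul_pos (inv_pos.2 (hsq _)) (mul_pos hε0 hζζ)
    have p2 : (√(q (-ε, t')))⁻¹ * (-ε * (ζ ⬝ᵥ ζ)) < 0 :=
      mul_neg_of_pos_of_neg (inv_pos.2 (hsq _)) (mul_neg_of_neg_of_pos (by linarith) hζζ)
    linarith

/-- The tensor field vanishes on all light directions. -/
lemma gv_eq_zero {n m : ℕ} (hn : 3 ≤ n) {c : ℝ} (hc : 0 < c)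
    {f : (Fin m → Fin (n + 1)) → (Fin (n + 1) → ℝ) → ℂ}
    (hreg : IsCc n m f) {ω₀ : Fin n → ℝ} (hω₀ : onSphere n ω₀) {δ : ℝ} (hδ : 0 < δ)
    (h : ∀ (x : Fin (n + 1) → ℝ) (ω : Fin n → ℝ), inBall n ω₀ δ ω →
      mlrt n m c m f x ω = 0) (w : Fin n → ℝ) (hw : onSphere n w) (x : Fin (n + 1) → ℝ) :
    gv n m f (ld n c w) x = 0 := by
  obtain ⟨U, hU, hadd, hne, hab⟩ := freq_cone hn c ω₀ hω₀ δ hδ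
  have hg := gv_continuous hreg (ld n c w)
  have hs := gv_compact hreg (ld n c w)
  have key : ∀ ξ ∈ U, ∫ x, (Real.exp (x ⬝ᵥ ξ) : ℂ) * gv n m f (ld n c w) x = 0 := by
    intro ξ hξ
    obtain ⟨a, b, ha, hb, hne, h1, h2⟩ := hab ξ hξ
    exact vanish_on_two hc hreg h a b w ha hb hne hw ξ h1 h2
  have hint : ∀ ξ, Integrable fun x => (Real.exp (x ⬝ᵥ ξ) : ℂ) * gv n m f (ld n c w) x := by
    intro ξ
    refine Continuous.integrable_of_hasCompactSupport ((?_ : Continuous _).mul hg) hs.mul_left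
    unfold dotProduct; fun_prop
  refine Complex.ext ?_ ?_
  · refine real_eq_zero_of_exp (n + 1) U hU hadd hne (fun x => (gv n m f (ld n c w) x).re)
      (Complex.continuous_re.comp hg) (hs.comp_left (g := Complex.re) rfl) ?_ x
    intro ξ hξ
    have := congrArg Complex.re (key ξ hξ)
    have h2 := integral_re (hint ξ)
    simp only [RCLike.re_to_complex] at h2
    rw [← h2] at this
    simpa [← Complex.ofReal_exp] using this
  · refine real_eq_zero_of_exp (n + 1) U hU hadd hne (fun x => (gv n m f (ld n c w) x).im)
      (Complex.continuous_im.comp hg) (hs.comp_left (g := Complex.im) rfl) ?_ x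
    intro ξ hξ
    have := congrArg Complex.im (key ξ hξ)
    have h2 := integral_im (hint ξ)
    simp only [RCLike.im_to_complex] at h2
    rw [← h2] at this
    simpa [← Complex.ofReal_exp] using this

/-- The quadratic form of `g_{1/c}`. -/
def qform (n : ℕ) (c : ℝ) : MvPolynomial (Fin (n + 1)) ℂ :=
  ∑ i : Fin n, MvPolynomial.X i.succ ^ 2 - MvPolynomial.C ((c : ℂ) ^ 2)⁻¹ * MvPolynomial.X 0 ^ 2

lemma qform_homog (n : ℕ) (c : ℝ) : (qform n c).IsHomogeneous 2 := by
  refine MvPolynomial.IsHomogeneous.sub (MvPolynomial.IsHomogeneous.sum _ _ _ fun i _ => ?_) ?_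
  · exact MvPolynomial.isHomogeneous_X_pow _ _
  · exact MvPolynomial.isHomogeneous_C_mul_X_pow _ _ _

lemma poly_dvd {n : ℕ} (hn : 0 < n) {c : ℝ} (hc : 0 < c) (p : MvPolynomial (Fin (n + 1)) ℂ)
    (hp : ∀ v : Fin (n + 1) → ℝ, v 0 ≠ 0 → c ^ 2 * ∑ i : Fin n, v i.succ ^ 2 = v 0 ^ 2 →
      MvPolynomial.eval (fun i => (v i : ℂ)) p = 0) :
    ∃ h, p = qform n c * h := by
  set s : MvPolynomial (Fin n) ℂ := MvPolynomial.C ((c : ℂ) ^ 2) * ∑ i, MvPolynomial.X i ^ 2 with hs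
  set D : Polynomial (MvPolynomial (Fin n) ℂ) := Polynomial.X ^ 2 - Polynomial.C s with hD
  have hmon : D.Monic := Polynomial.monic_X_pow_sub_C s two_ne_zero
  have hdeg : D.degree = 2 := Polynomial.degree_X_pow_sub_C two_pos s
  set P := MvPolynomial.finSuccEquiv ℂ n p with hP
  set R := P %ₘ D with hR
  have hRdeg : R.degree ≤ 1 := by
    have := Polynomial.degree_modByMonic_lt P hmon
    rw [hdeg] at this
    exact Order.le_of_lt_succ this
  have hRX := Polynomial.eq_X_add_C_of_degree_le_one hRdeg
  have hdiv : R + D * (P /ₘ D) = P := Polynomial.modByMonic_add_div P D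
  have key : ∀ v : Fin n → ℝ, (∀ i, 0 < v i) →
      MvPolynomial.eval (fun i => (v i : ℂ)) (R.coeff 1) = 0 ∧
      MvPolynomial.eval (fun i => (v i : ℂ)) (R.coeff 0) = 0 := by
    intro v hv
    have hS : 0 < ∑ i, v i ^ 2 :=
      sum_pos (fun i _ => pow_pos (hv i) 2) ⟨⟨0, hn⟩, mem_univ _⟩
    have main : ∀ t : ℝ, t ≠ 0 → c ^ 2 * ∑ i, v i ^ 2 = t ^ 2 →
        MvPolynomial.eval (fun i => (v i : ℂ)) (R.coeff 1) * t +
        MvPolynomial.eval (fun i => (v i : ℂ)) (R.coeff 0) = 0 := by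
      intro t ht0 ht
      have h1 := hp (Fin.cons t v) (by simpa using ht0) (by simpa using ht)
      have h2 : (fun i => ((Fin.cons t v : Fin (n + 1) → ℝ) i : ℂ)) =
          Fin.cons (t : ℂ) (fun i => (v i : ℂ)) := by
        ext i
        refine Fin.cases ?_ (fun j => ?_) i <;> simp
      rw [h2, MvPolynomial.eval_eq_eval_mv_eval', ← hP, ← hdiv] at h1
      have h3 : Polynomial.eval (t : ℂ) (Polynomial.map (MvPolynomial.eval fun i => (v i : ℂ)) D)
          = 0 := by
        have : ((c : ℂ) ^ 2 * ∑ i, (v i : ℂ) ^ 2) = (t : ℂ) ^ 2 := by exact_mod_cast ht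
        rw [hD, Polynomial.map_sub, Polynomial.map_pow, Polynomial.map_X, Polynomial.map_C]
        simp [hs, this]
      rw [Polynomial.map_add, Polynomial.map_mul, Polynomial.eval_add, Polynomial.eval_mul, h3,
        zero_mul, add_zero, hRX] at h1
      simpa using h1
    set t := c * √(∑ i, v i ^ 2) with ht
    have htpos : 0 < t := mul_pos hc (Real.sqrt_pos.2 hS)
    have htsq : c ^ 2 * ∑ i, v i ^ 2 = t ^ 2 := by
      rw [ht, mul_pow, Real.sq_sqrt hS.le]
    have m1 := main t htpos.ne' htsq
    have m2 := main (-t) (neg_ne_zero.2 htpos.ne') (by rw [htsq]; ring)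
    push_cast at m2
    have ht' : (t : ℂ) ≠ 0 := by exact_mod_cast htpos.ne'
    have e1 : MvPolynomial.eval (fun i => (v i : ℂ)) (R.coeff 0) = 0 := by
      linear_combination (m1 + m2) / 2
    refine ⟨?_, e1⟩
    rw [e1, add_zero] at m1
    exact (mul_eq_zero.1 m1).resolve_right ht'
  have hinf : ∀ _ : Fin n, ((fun r : ℝ => (r : ℂ)) '' Set.Ioi 0).Infinite := fun _ =>
    (Set.Ioi_infinite 0).image Complex.ofReal_injective.injOn
  have hz : ∀ r : MvPolynomial (Fin n) ℂ, (∀ v : Fin n → ℝ, (∀ i, 0 < v i) →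
      MvPolynomial.eval (fun i => (v i : ℂ)) r = 0) → r = 0 := by
    intro r hr
    refine MvPolynomial.funext_set _ hinf fun x hx => ?_
    have hx' : ∀ i, ∃ r : ℝ, 0 < r ∧ (r : ℂ) = x i := fun i => hx i (Set.mem_univ i)
    choose v hv hvx using hx'
    have := hr v hv
    simp only [hvx] at this
    rw [map_zero]; exact this
  have hR0 : R = 0 := by
    rw [hRX, hz _ fun v hv => (key v hv).1, hz _ fun v hv => (key v hv).2]; simp
  rw [hR0, zero_add] at hdiv
  have hsymm : (MvPolynomial.finSuccEquiv ℂ n) (qform n c) =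
      Polynomial.C (MvPolynomial.C (-((c : ℂ) ^ 2)⁻¹)) * D := by
    have hc' : (c : ℂ) ≠ 0 := by exact_mod_cast hc.ne'
    have hcc : (MvPolynomial.C (-((c : ℂ) ^ 2)⁻¹) : MvPolynomial (Fin n) ℂ) *
        MvPolynomial.C ((c : ℂ) ^ 2) = -1 := by
      rw [← map_mul, neg_mul, inv_mul_cancel₀ (pow_ne_zero 2 hc')]; simp
    simp only [qform, hD, hs, map_sub, map_sum, map_mul, map_pow, MvPolynomial.finSuccEquiv_X_succ,
      MvPolynomial.finSuccEquiv_X_zero, mul_sub]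
    rw [← mul_assoc, ← map_pow, ← map_pow MvPolynomial.C, ← map_mul, hcc]
    have : (MvPolynomial.finSuccEquiv ℂ n) (MvPolynomial.C ((c : ℂ) ^ 2)⁻¹) =
      Polynomial.C (MvPolynomial.C (((c : ℂ) ^ 2)⁻¹)) := by simp [MvPolynomial.finSuccEquiv_apply]
    rw [this]
    simp
    ring
  refine ⟨(MvPolynomial.finSuccEquiv ℂ n).symm
    (Polynomial.C (MvPolynomial.C (-((c : ℂ) ^ 2))) * (P /ₘ D)), ?_⟩
  apply (MvPolynomial.finSuccEquiv ℂ n).injective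
  rw [map_mul, hsymm, AlgEquiv.apply_symm_apply, ← hP]
  have hc' : (c : ℂ) ≠ 0 := by exact_mod_cast hc.ne'
  have hcc : (Polynomial.C (MvPolynomial.C (-((c : ℂ) ^ 2)⁻¹)) :
        Polynomial (MvPolynomial (Fin n) ℂ)) *
        Polynomial.C (MvPolynomial.C (-((c : ℂ) ^ 2))) = 1 := by
      rw [← map_mul, ← map_mul, neg_mul_neg, inv_mul_cancel₀ (pow_ne_zero 2 hc')]; simp
  calc P = 1 * (D * (P /ₘ D)) := by rw [one_mul, hdiv]
    _ = _ := by rw [← hcc]; ring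

lemma homog_factor {σ : Type*} {p q h : MvPolynomial σ ℂ} {m : ℕ} (hp : p.IsHomogeneous m)
    (hq : q.IsHomogeneous 2) (hph : p = q * h) :
    (m < 2 → p = 0) ∧ ∀ m', m = m' + 2 → ∃ h', h'.IsHomogeneous m' ∧ p = q * h' := by
  letI := MvPolynomial.gradedAlgebra (σ := σ) (R := ℂ)
  have e0 : (DirectSum.decompose (MvPolynomial.homogeneousSubmodule σ ℂ) p m : MvPolynomial σ ℂ)
      = p := DirectSum.decompose_of_mem_same _ hp
  constructor
  · intro hm
    rw [hph, DirectSum.coe_decompose_mul_of_left_mem_of_not_le _ hq (by omega)] at e0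
    rw [hph, ← e0]
  · rintro m' rfl
    refine ⟨DirectSum.decompose (MvPolynomial.homogeneousSubmodule σ ℂ) h m', 
      (DirectSum.decompose (MvPolynomial.homogeneousSubmodule σ ℂ) h m').2, ?_⟩
    rw [hph, add_comm, DirectSum.coe_decompose_mul_add_of_left_mem _ hq] at e0
    rw [hph, e0]

/-- The exponent of the monomial `∏ X_{I j}`. -/
def cnt {m : ℕ} {ι : Type*} (I : Fin m → ι) : ι →₀ ℕ := ∑ j, Finsupp.single (I j) 1

/-- The polynomial of a tensor. -/
def tp {m : ℕ} {ι : Type*} [Fintype ι] (F : (Fin m → ι) → ℂ) : MvPolynomial ι ℂ :=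
  ∑ I, MvPolynomial.monomial (cnt I) (F I)

lemma cnt_degree {m : ℕ} {ι : Type*} (I : Fin m → ι) : (cnt I).degree = m := by
  simp [cnt, map_sum]

lemma cnt_comp {m : ℕ} {ι : Type*} (I : Fin m → ι) (σ : Equiv.Perm (Fin m)) :
    cnt (I ∘ σ) = cnt I :=
  Equiv.sum_comp σ fun j => Finsupp.single (I j) 1

lemma tp_homog {m : ℕ} {ι : Type*} [Fintype ι] (F : (Fin m → ι) → ℂ) : (tp F).IsHomogeneous m :=
  MvPolynomial.IsHomogeneous.sum _ _ _ fun I _ =>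
    MvPolynomial.isHomogeneous_monomial _ (cnt_degree I)

lemma tp_eval {m : ℕ} {ι : Type*} [Fintype ι] (F : (Fin m → ι) → ℂ) (v : ι → ℂ) :
    MvPolynomial.eval v (tp F) = ∑ I, (∏ j, v (I j)) * F I := by
  rw [tp, map_sum]
  refine sum_congr rfl fun I _ => ?_
  rw [cnt, MvPolynomial.monomial_sum_index, map_mul, map_prod, MvPolynomial.eval_C, mul_comm]
  congr 1
  exact prod_congr rfl fun j _ => MvPolynomial.eval_X (I j)

lemma cnt_apply {m : ℕ} {ι : Type*} [DecidableEq ι] (I : Fin m → ι) (a : ι) :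
    cnt I a = Fintype.card {j // I j = a} := by
  rw [cnt, Finsupp.finsetSum_apply, Fintype.card_subtype, Finset.card_filter]
  exact sum_congr rfl fun j _ => by rw [Finsupp.single_apply]

lemma exists_perm {m : ℕ} {ι : Type*} (I J : Fin m → ι) (h : cnt J = cnt I) :
    ∃ σ : Equiv.Perm (Fin m), J = I ∘ σ := by
  classical
  have e : ∀ a, {j // J j = a} ≃ {j // I j = a} := fun a =>
    Fintype.equivOfCardEq (by simpa [cnt_apply, Fintype.card_subtype] using DFunLike.congr_fun h a)
  refine ⟨Equiv.ofFiberEquiv e, ?_⟩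
  ext j
  exact (Equiv.ofFiberEquiv_map e j).symm

lemma tp_coeff {m : ℕ} {ι : Type*} [Fintype ι] [DecidableEq ι] (F : (Fin m → ι) → ℂ)
    (d : ι →₀ ℕ) : (tp F).coeff d = ∑ J with cnt J = d, F J := by
  rw [tp, MvPolynomial.coeff_sum, Finset.sum_filter]
  exact sum_congr rfl fun J _ => by rw [MvPolynomial.coeff_monomial]

lemma tp_inj {m : ℕ} {ι : Type*} [Fintype ι] (F : (Fin m → ι) → ℂ)
    (hF : ∀ (σ : Equiv.Perm (Fin m)) I, F (I ∘ σ) = F I) (h : tp F = 0) : F = 0 := by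
  classical
  ext I
  have h1 := tp_coeff F (cnt I)
  rw [h, MvPolynomial.coeff_zero] at h1
  have h2 : ∑ J : Fin m → ι with cnt J = cnt I, F J = ∑ J : Fin m → ι with cnt J = cnt I, F I := by
    refine sum_congr rfl fun J hJ => ?_
    obtain ⟨σ, rfl⟩ := exists_perm I J (by simpa using hJ)
    exact hF σ I
  rw [h2, sum_const, nsmul_eq_mul] at h1
  have h3 : (univ.filter fun J : Fin m → ι => cnt J = cnt I).card ≠ 0 :=
    card_ne_zero.2 ⟨I, by simp⟩
  rcases mul_eq_zero.1 h1.symm with h4 | h4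
  · exact absurd (by exact_mod_cast h4) h3
  · simpa using h4

lemma cnt_list {ι : Type*} (l : List ι) : Finsupp.toMultiset (cnt l.get) = (l : Multiset ι) := by
  induction l with
  | nil => simp [cnt]
  | cons a l ih =>
    rw [cnt, map_sum] at ih ⊢
    simp only [Finsupp.toMultiset_single, one_smul] at ih ⊢
    change ∑ j : Fin (l.length + 1), _ = _
    rw [Fin.sum_univ_succ, ← Multiset.cons_coe, ← ih]
    rfl

lemma exists_cnt {m : ℕ} {ι : Type*} (d : ι →₀ ℕ) (hd : d.degree = m) :
    ∃ I : Fin m → ι, cnt I = d := by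
  classical
  obtain ⟨l, hl⟩ := Quot.exists_rep (Finsupp.toMultiset d)
  have hl' : (l : Multiset ι) = Finsupp.toMultiset d := hl
  have hlen : l.length = m := by
    rw [← hd, ← Multiset.coe_card, hl', Finsupp.card_toMultiset]
    rfl
  subst hlen
  refine ⟨l.get, ?_⟩
  apply Multiset.toFinsupp.symm.injective
  change Finsupp.toMultiset _ = Finsupp.toMultiset _
  rw [cnt_list, hl']

lemma exists_tp {m : ℕ} {ι : Type*} [Fintype ι] (h : MvPolynomial ι ℂ) (hh : h.IsHomogeneous m) :
    ∃ u : (Fin m → ι) → ℂ, (∀ (σ : Equiv.Perm (Fin m)) I, u (I ∘ σ) = u I) ∧ tp u = h := by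
  classical
  refine ⟨fun I => h.coeff (cnt I) / (univ.filter fun J : Fin m → ι => cnt J = cnt I).card, ?_, ?_⟩
  · intro σ I
    simp only [cnt_comp]
  · ext d
    rw [tp_coeff]
    by_cases hd : d.degree = m
    · obtain ⟨I, rfl⟩ := exists_cnt d hd
      have : ∀ J ∈ univ.filter (fun J : Fin m → ι => cnt J = cnt I),
          h.coeff (cnt J) / ((univ.filter fun K : Fin m → ι => cnt K = cnt J).card : ℂ) =
          h.coeff (cnt I) / (univ.filter fun K : Fin m → ι => cnt K = cnt I).card := by
        intro J hJ
        rw [(mem_filter.1 hJ).2]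
      rw [sum_congr rfl this, sum_const, nsmul_eq_mul, mul_div_cancel₀]
      have h3 : (univ.filter fun J : Fin m → ι => cnt J = cnt I).card ≠ 0 :=
        card_ne_zero.2 ⟨I, by simp⟩
      exact_mod_cast h3
    · rw [hh.coeff_eq_zero hd]
      refine sum_eq_zero fun J hJ => ?_
      exact absurd (by rw [← (mem_filter.1 hJ).2, cnt_degree]) hd

/-- The pointwise version of `iOpF`, as a linear map. -/
def iPt (n m : ℕ) (v : Fin (n + 1) → Fin (n + 1) → ℝ) :
    ((Fin m → Fin (n + 1)) → ℂ) →ₗ[ℂ] ((Fin (m + 2) → Fin (n + 1)) → ℂ) where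
  toFun u := fun i => iOpF n m v (fun I _ => u I) i 0
  map_add' u w := by
    ext i
    simp only [iOpF, Pi.add_apply, add_mul, sum_add_distrib, mul_add]
  map_smul' r u := by
    ext i
    simp only [iOpF, Pi.smul_apply, smul_eq_mul, mul_assoc, RingHom.id_apply, ← mul_sum]
    ring

lemma iPt_apply (n m : ℕ) (v : Fin (n + 1) → Fin (n + 1) → ℝ) (u : (Fin m → Fin (n + 1)) → ℂ)
    (i : Fin (m + 2) → Fin (n + 1)) : iPt n m v u i = ((m + 2).factorial : ℂ)⁻¹ *
    ∑ π : Equiv.Perm (Fin (m + 2)),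
      u (fun j => i (π j.castSucc.castSucc)) *
        (v (i (π (Fin.last m).castSucc)) (i (π (Fin.last (m + 1)))) : ℂ) := rfl

lemma iPt_symm (n m : ℕ) (v : Fin (n + 1) → Fin (n + 1) → ℝ) (u : (Fin m → Fin (n + 1)) → ℂ)
    (σ : Equiv.Perm (Fin (m + 2))) (i : Fin (m + 2) → Fin (n + 1)) :
    iPt n m v u (i ∘ σ) = iPt n m v u i := by
  rw [iPt_apply, iPt_apply]
  congr 1
  exact Equiv.sum_comp (Equiv.mulLeft σ) fun π : Equiv.Perm (Fin (m + 2)) =>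
      u (fun j => i (π j.castSucc.castSucc)) *
        (v (i (π (Fin.last m).castSucc)) (i (π (Fin.last (m + 1)))) : ℂ)

lemma gmet_eval (n : ℕ) (c : ℝ) (z : Fin (n + 1) → ℂ) :
    ∑ b, ∑ a, z a * z b * (gmet n c a b : ℂ) = MvPolynomial.eval z (qform n c) := by
  have : ∀ b, ∑ a, z a * z b * (gmet n c a b : ℂ) =
      z b ^ 2 * (if b = 0 then -(1 / (c : ℂ) ^ 2) else 1) := by
    intro b
    rw [Finset.sum_eq_single b]
    · simp only [gmet, if_true]
      split_ifs <;> push_cast <;> ring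
    · intro a _ hab
      simp [gmet, hab]
    · simp
  simp_rw [this]
  rw [Fin.sum_univ_succ]
  simp [qform, Fin.succ_ne_zero]
  ring

lemma tp_iPt (n m : ℕ) (c : ℝ) (u : (Fin m → Fin (n + 1)) → ℂ) :
    tp (iPt n m (gmet n c) u) = qform n c * tp u := by
  refine MvPolynomial.funext fun z => ?_
  rw [map_mul, tp_eval, tp_eval, ← gmet_eval]
  let B : (Fin (m + 2) → Fin (n + 1)) → ℂ := fun I => (∏ j, z (I j)) *
    (u (fun j => I j.castSucc.castSucc) * (gmet n c (I (Fin.last m).castSucc) (I (Fin.last (m + 1))) : ℂ))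
  have h1 : ∑ I, (∏ j, z (I j)) * iPt n m (gmet n c) u I = ∑ I, B I := by
    have h0 : ∀ I, (∏ j, z (I j)) * iPt n m (gmet n c) u I = ((m + 2).factorial : ℂ)⁻¹ *
        ∑ π : Equiv.Perm (Fin (m + 2)), (∏ j, z (I j)) * (u (fun j => I (π j.castSucc.castSucc)) *
        (gmet n c (I (π (Fin.last m).castSucc)) (I (π (Fin.last (m + 1)))) : ℂ)) := by
      intro I
      rw [iPt_apply, mul_left_comm, mul_sum]
    rw [sum_congr rfl fun I _ => h0 I, ← mul_sum, sum_comm]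
    have : ∀ π : Equiv.Perm (Fin (m + 2)), ∑ I : Fin (m + 2) → Fin (n + 1), (∏ j, z (I j)) *
        (u (fun j => I (π j.castSucc.castSucc)) *
        (gmet n c (I (π (Fin.last m).castSucc)) (I (π (Fin.last (m + 1)))) : ℂ)) = ∑ I, B I := by
      intro π
      rw [← Equiv.sum_comp (Equiv.arrowCongr π.symm (Equiv.refl (Fin (n + 1)))) B]
      refine sum_congr rfl fun I _ => ?_
      simp only [B]
      congr 1
      exact (Equiv.prod_comp π fun j => z (I j)).symm
    rw [sum_congr rfl fun π _ => this π, sum_const, card_univ, Fintype.card_perm, Fintype.card_fin,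
      nsmul_eq_mul, ← mul_assoc, inv_mul_cancel₀ (by exact_mod_cast Nat.factorial_ne_zero _), one_mul]
  rw [h1, ← Equiv.sum_comp (Fin.snocEquiv fun _ => Fin (n + 1)), Fintype.sum_prod_type, sum_mul]
  refine sum_congr rfl fun b _ => ?_
  rw [← Equiv.sum_comp (Fin.snocEquiv fun _ => Fin (n + 1)), Fintype.sum_prod_type, sum_mul]
  refine sum_congr rfl fun a _ => ?_
  rw [mul_sum]
  refine sum_congr rfl fun J _ => ?_
  simp [B, Fin.snocEquiv, Fin.prod_univ_castSucc]
  ring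

/-- (Partial data, `n ≥ 3`.) If `L̃^{m,m} f` vanishes for all base points
and all `ω ∈ B_n(ω₀, δ)`, then `f = 0` when `m ∈ {0,1}`, and `f = i_{g_{1/c}} f^{(m-2)}`
for some smooth compactly supported symmetric `(m-2)`-tensor field when `m ≥ 2`. -/
theorem mlrt_partial_sphere_kernel
    (n m : ℕ) (hn : 3 ≤ n) (c : ℝ) (hc : 0 < c)
    (ω₀ : Fin n → ℝ) (hω₀ : onSphere n ω₀) (δ : ℝ) (hδ : 0 < δ)
    (f : (Fin m → Fin (n + 1)) → (Fin (n + 1) → ℝ) → ℂ)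
    (hsym : IsSymmF n m f) (hreg : IsCc n m f)
    (h : ∀ (x : Fin (n + 1) → ℝ) (ω : Fin n → ℝ), inBall n ω₀ δ ω →
      mlrt n m c m f x ω = 0) :
    (m = 0 ∨ m = 1 → ∀ i x, f i x = 0) ∧
    (∀ (m' : ℕ) (hm : m = m' + 2),
      ∃ u : (Fin m' → Fin (n + 1)) → (Fin (n + 1) → ℝ) → ℂ,
        IsSymmF n m' u ∧ IsCc n m' u ∧
        ∀ (i : Fin (m' + 2) → Fin (n + 1)) (x : Fin (n + 1) → ℝ),
          f (fun j => i (Fin.cast hm j)) x = iOpF n m' (gmet n c) u i x) := by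
  have hgv := gv_eq_zero hn hc hreg hω₀ hδ h
  have hfac := fun x => poly_dvd (by omega : 0 < n) hc (tp fun I => f I x) fun v hv0 hv => by
    have hω : onSphere n fun i => c * v i.succ / v 0 := by
      unfold onSphere
      simp_rw [div_pow, mul_pow]
      rw [← sum_div, ← mul_sum, hv]
      exact div_self (pow_ne_zero 2 hv0)
    have e1 : v = (v 0 / c) • ld n c fun i => c * v i.succ / v 0 := by
      ext i
      refine Fin.cases ?_ (fun j => ?_) i
      · simp [ld]; field_simp
      · simp [ld]; field_simp
    have e2 := gv_smul f (v 0 / c) (ld n c fun i => c * v i.succ / v 0) x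
    rw [← e1, hgv _ hω x, mul_zero] at e2
    rw [tp_eval]
    exact e2
  choose k hk using hfac
  have hhom := fun x => homog_factor (tp_homog fun I => f I x) (qform_homog n c) (hk x)
  have hs : ∀ x (σ : Equiv.Perm (Fin m)) (I : Fin m → Fin (n + 1)), f (I ∘ σ) x = f I x :=
    fun x σ I => congrFun (hsym σ I) x
  constructor
  · intro hm i x
    exact congrFun (tp_inj (fun I => f I x) (hs x) ((hhom x).1 (by omega))) i
  · intro m' hm
    subst hm
    let S : Submodule ℂ ((Fin m' → Fin (n + 1)) → ℂ) :=
      { carrier := {u | ∀ (σ : Equiv.Perm (Fin m')) I, u (I ∘ σ) = u I}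
        add_mem' := fun {a b} ha hb σ I => by rw [Pi.add_apply, Pi.add_apply, ha, hb]
        zero_mem' := fun σ I => rfl
        smul_mem' := fun r a ha σ I => by rw [Pi.smul_apply, Pi.smul_apply, ha] }
    let A := (iPt n m' (gmet n c)).comp S.subtype
    obtain ⟨r, hr⟩ := A.rangeRestrict.exists_rightInverse_of_surjective
      (LinearMap.range_eq_top.2 A.surjective_rangeRestrict)
    obtain ⟨g, hg⟩ := LinearMap.exists_extend r
    let T := S.subtype.comp g
    have hT : ∀ x, iPt n m' (gmet n c) (T fun I => f I x) = fun I => f I x := by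
      intro x
      obtain ⟨k', hk', hkk⟩ := (hhom x).2 m' rfl
      obtain ⟨u, hu, rfl⟩ := exists_tp k' hk'
      have hmem : A ⟨u, hu⟩ = fun I => f I x := by
        rw [← sub_eq_zero]
        refine tp_inj _ (fun σ I => ?_) ?_
        · simp only [Pi.sub_apply]
          rw [hs x σ I]
          exact congrArg (· - f I x) (iPt_symm n m' (gmet n c) u σ I)
        · have : tp (A ⟨u, hu⟩ - fun I => f I x) = tp (A ⟨u, hu⟩) - tp (fun I => f I x) := by
            simp [tp, sum_sub_distrib]
          rw [this, hkk, sub_eq_zero]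
          exact tp_iPt n m' c u
      have hg1 := LinearMap.congr_fun hg (A.rangeRestrict ⟨u, hu⟩)
      have hr1 := LinearMap.congr_fun hr (A.rangeRestrict ⟨u, hu⟩)
      rw [← hmem]
      change A (g (A ⟨u, hu⟩)) = A ⟨u, hu⟩
      have hg2 : g (A ⟨u, hu⟩) = r (A.rangeRestrict ⟨u, hu⟩) := hg1
      rw [hg2]
      exact congrArg Subtype.val hr1
    refine ⟨fun I x => T (fun J => f J x) I, ?_, ?_, ?_⟩
    · intro σ I
      ext x
      exact (g fun J => f J x).2 σ I
    · intro I
      constructor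
      · have h1 : ContDiff ℝ (⊤ : ℕ∞) fun x => fun J => f J x :=
          contDiff_pi.2 fun J => (hreg J).1
        have h2 : ContDiff ℝ (⊤ : ℕ∞) fun x => T (fun J => f J x) :=
          (LinearMap.toContinuousLinearMap (T.restrictScalars ℝ)).contDiff.comp h1
        exact contDiff_pi.1 h2 I
      · have hK : IsCompact (⋃ i, tsupport (f i)) := isCompact_iUnion fun i => (hreg i).2
        refine HasCompactSupport.intro hK fun x hx => ?_
        have : (fun J => f J x) = 0 := by
          ext J
          exact image_eq_zero_of_notMem_tsupport fun h => hx (Set.mem_iUnion.2 ⟨J, h⟩)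
        change T (fun J => f J x) I = 0
        rw [this, map_zero]; rfl
    · intro i x
      exact (congrFun (hT x) i).symm
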